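/- Let γ ∈ [0,1] and b(z) := −2|z|^γ z on ℝ³. Then the convolution b̄ := b*μ satisfies, for every v ∈ ℝ³, b̄_i(v) = −ā_{ij}(v) v_j (summation over j); in particular, for v ≠ 0, b̄(v) = −ℓ₁(v) v, where ℓ₁(v) := ∫_{ℝ³} (1 − ((v/|v|)·(w/|w|))²) |w|^{γ+2} μ(v−w) dw is the eigenvalue of ā(v) in the direction v. -/

import Mathlib

open MeasureTheory Real Filter

noncomputable section

abbrev E3 : Type := EuclideanSpace ℝ (Fin 3)

/-- The standard Gaussian on ℝ³. -/
def gauss (v : E3) : ℝ :=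
  (2 * π) ^ (-(3 : ℝ) / 2) * Real.exp (-‖v‖ ^ 2 / 2)

/-- `J_α(v) = ∫ |v - w|^α μ(w) dw`. -/
def Jfun (α : ℝ) (v : E3) : ℝ :=
  ∫ w : E3, ‖v - w‖ ^ α * gauss w

/-- The matrix `a_{ij}(z) = |z|^{γ+2} (δ_{ij} - z_i z_j / |z|²)` (equal to `0` at `z = 0`). -/
def amat (γ : ℝ) (z : E3) (i j : Fin 3) : ℝ :=
  ‖z‖ ^ (γ + 2) * ((if i = j then (1 : ℝ) else 0) - z i * z j / ‖z‖ ^ 2)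

/-- The entrywise convolution `ā = a * μ`. -/
def abar (γ : ℝ) (v : E3) (i j : Fin 3) : ℝ :=
  ∫ w : E3, amat γ (v - w) i j * gauss w

/-- The eigenvalue `ℓ₁(v)` of `ā(v)` in the direction `v`. -/
def ell1 (γ : ℝ) (v : E3) : ℝ :=
  ∫ w : E3, (1 - (∑ i, (v i / ‖v‖) * (w i / ‖w‖)) ^ 2) * ‖w‖ ^ (γ + 2) * gauss (v - w)

/-- Squared norm of the cross product of two vectors of ℝ³. -/
def crossSq (u w : Fin 3 → ℝ) : ℝ :=
  (u 1 * w 2 - u 2 * w 1) ^ 2 + (u 2 * w 0 - u 0 * w 2) ^ 2 + (u 0 * w 1 - u 1 * w 0) ^ 2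

/-- The eigenvalue `ℓ₂(v)` of `ā(v)` on `v^⊥`. -/
def ell2 (γ : ℝ) (v : E3) : ℝ :=
  ∫ w : E3, (1 - (1 / 2) * crossSq (fun i => v i / ‖v‖) (fun i => w i / ‖w‖)) *
    ‖w‖ ^ (γ + 2) * gauss (v - w)

/-- `b(z) = -2 |z|^γ z`. -/
def bvec (γ : ℝ) (z : E3) (i : Fin 3) : ℝ := -2 * ‖z‖ ^ γ * z i

/-- The convolution `b̄ = b * μ`. -/
def bbar (γ : ℝ) (v : E3) (i : Fin 3) : ℝ :=
  ∫ w : E3, bvec γ (v - w) i * gauss w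

lemma gauss_nonneg (w : E3) : 0 ≤ gauss w := by unfold gauss; positivity

lemma gauss_cont : Continuous gauss := by unfold gauss; fun_prop

lemma exp_bound (x : ℝ) (hx : 0 ≤ x) :
    (1 + x) ^ 8 * Real.exp (-x ^ 2 / 2) ≤ 6144 * Real.exp (1 / 2) := by
  have h1 := Real.pow_div_factorial_le_exp (x := (1 + x ^ 2) / 2) (by positivity) 4
  have h2 : (1 + x) ^ 2 ≤ 2 * (1 + x ^ 2) := by nlinarith [sq_nonneg (1 - x)]
  have h3 : (1 + x) ^ 8 ≤ (2 * (1 + x ^ 2)) ^ 4 := by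
    calc (1 + x) ^ 8 = ((1 + x) ^ 2) ^ 4 := by ring
      _ ≤ _ := pow_le_pow_left₀ (by positivity) h2 4
  have h4 : (1 + x) ^ 8 ≤ 6144 * Real.exp ((1 + x ^ 2) / 2) := by
    have : ((Nat.factorial 4 : ℕ) : ℝ) = 24 := by norm_num [Nat.factorial]
    rw [this] at h1
    have : (2 * (1 + x ^ 2)) ^ 4 = 6144 * (((1 + x ^ 2) / 2) ^ 4 / 24) := by ring
    linarith
  calc (1 + x) ^ 8 * Real.exp (-x ^ 2 / 2)
      ≤ 6144 * Real.exp ((1 + x ^ 2) / 2) * Real.exp (-x ^ 2 / 2) := by gcongr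
    _ = 6144 * Real.exp (1 / 2) := by
      rw [mul_assoc, ← Real.exp_add]; congr 2; ring

lemma integrable_gauss_mul (g : E3 → ℝ) (hg : Measurable g) (C : ℝ)
    (hC : ∀ w, |g w| ≤ C * (1 + ‖w‖) ^ 4) : Integrable (fun w => g w * gauss w) := by
  have h0 : Integrable (fun w : E3 => (1 + ‖w‖) ^ (-(4 : ℝ))) :=
    integrable_one_add_norm (by simp; norm_num)
  have hC0 : 0 ≤ C := by
    have := hC 0
    simp at this
    exact (abs_nonneg _).trans this
  refine (h0.const_mul (C * ((2 * π) ^ (-(3 : ℝ) / 2) * (6144 * Real.exp (1 / 2))))).mono'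
    (hg.mul gauss_cont.measurable).aestronglyMeasurable (Eventually.of_forall fun w => ?_)
  have hp : (0 : ℝ) < 1 + ‖w‖ := by positivity
  have hr : (1 + ‖w‖) ^ (-(4 : ℝ)) = ((1 + ‖w‖) ^ 4)⁻¹ := by
    rw [Real.rpow_neg hp.le]; norm_cast
  rw [hr, Real.norm_eq_abs, abs_mul, abs_of_nonneg (gauss_nonneg w), ← div_eq_mul_inv,
    le_div_iff₀ (by positivity)]
  calc |g w| * gauss w * (1 + ‖w‖) ^ 4
      ≤ (C * (1 + ‖w‖) ^ 4) * gauss w * (1 + ‖w‖) ^ 4 := by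
        have := gauss_nonneg w
        have := hC w
        gcongr
    _ = C * ((2 * π) ^ (-(3 : ℝ) / 2) * ((1 + ‖w‖) ^ 8 * Real.exp (-‖w‖ ^ 2 / 2))) := by
        unfold gauss; ring
    _ ≤ _ := by
        have := exp_bound ‖w‖ (norm_nonneg w)
        gcongr

lemma integrable_conv (g : E3 → ℝ) (hg : Measurable g) (C : ℝ) (v : E3)
    (hC : ∀ w, |g w| ≤ C * (1 + ‖w‖) ^ 3) : Integrable (fun w => g (v - w) * gauss w) ∧
    ∀ j, Integrable (fun w => g (v - w) * (w j * gauss w)) := by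
  have hC0 : 0 ≤ C := by
    have := hC 0
    simp at this
    exact (abs_nonneg _).trans this
  have hb : ∀ w, |g (v - w)| ≤ (C * (1 + ‖v‖) ^ 3) * (1 + ‖w‖) ^ 3 := by
    intro w
    refine (hC _).trans ?_
    have : 1 + ‖v - w‖ ≤ (1 + ‖v‖) * (1 + ‖w‖) := by
      nlinarith [norm_sub_le v w, mul_nonneg (norm_nonneg v) (norm_nonneg w)]
    calc C * (1 + ‖v - w‖) ^ 3 ≤ C * ((1 + ‖v‖) * (1 + ‖w‖)) ^ 3 := by gcongr
      _ = _ := by ring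
  have hm : Measurable (fun w => g (v - w)) := hg.comp (by fun_prop)
  constructor
  · refine integrable_gauss_mul _ hm (C * (1 + ‖v‖) ^ 3) fun w => (hb w).trans ?_
    gcongr
    · linarith [norm_nonneg w]
    · norm_num
  · intro j
    have := integrable_gauss_mul (fun w => g (v - w) * w j) (hm.mul (by fun_prop))
      (C * (1 + ‖v‖) ^ 3) fun w => by
        rw [abs_mul]
        have h1 : |w j| ≤ 1 + ‖w‖ := by
          have := PiLp.norm_apply_le w j
          rw [Real.norm_eq_abs] at this
          linarith
        calc |g (v - w)| * |w j| ≤ ((C * (1 + ‖v‖) ^ 3) * (1 + ‖w‖) ^ 3) * (1 + ‖w‖) := by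
              have := hb w
              gcongr
          _ = _ := by ring
    refine this.congr (Eventually.of_forall fun w => ?_)
    simp only; ring

/-- regularised form of `amat` -/
def afun (γ : ℝ) (i j : Fin 3) (z : E3) : ℝ :=
  (if i = j then (1 : ℝ) else 0) * ‖z‖ ^ (γ + 2) - ‖z‖ ^ γ * (z i * z j)

/-- its `j`-th partial derivative -/
def adfun (γ : ℝ) (i j : Fin 3) (z : E3) : ℝ :=
  (if i = j then (1 : ℝ) else 0) * ((γ + 2) * ‖z‖ ^ γ * z j) -
    (γ * ‖z‖ ^ (γ - 2) * z j * (z i * z j) +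
      ‖z‖ ^ γ * ((if i = j then (1 : ℝ) else 0) * z j + z i))

lemma rpow_add_two' (γ : ℝ) (hγ : 0 ≤ γ) (z : E3) : ‖z‖ ^ (γ + 2) = ‖z‖ ^ γ * ‖z‖ ^ 2 := by
  have := Real.rpow_add_of_nonneg (norm_nonneg z) hγ (show (0 : ℝ) ≤ 2 by norm_num)
  rw [this]; norm_cast

lemma amat_eq (γ : ℝ) (hγ : 0 ≤ γ) (i j : Fin 3) (z : E3) : amat γ z i j = afun γ i j z := by
  unfold amat afun
  rw [rpow_add_two' γ hγ]
  by_cases hz : z = 0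
  · simp [hz]
  · have : ‖z‖ ≠ 0 := by simpa using hz
    field_simp

lemma hasFDerivAt_norm_rpow_ne (γ : ℝ) (z : E3) (hz : z ≠ 0) :
    HasFDerivAt (fun x : E3 => ‖x‖ ^ γ) ((γ * ‖z‖ ^ (γ - 2)) • innerSL ℝ z) z := by
  have hp : 0 < ‖z‖ := by simpa using hz
  have h1 := (hasStrictFDerivAt_norm_sq z).hasFDerivAt.rpow_const (p := γ / 2) (Or.inl (by positivity))
  have e : ∀ x : E3, (‖x‖ ^ 2) ^ (γ / 2) = ‖x‖ ^ γ := by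
    intro x
    rw [← Real.rpow_natCast, ← Real.rpow_mul (norm_nonneg x)]
    congr 1; push_cast; ring
  have e2 : (‖z‖ ^ 2) ^ (γ / 2 - 1) = ‖z‖ ^ (γ - 2) := by
    rw [← Real.rpow_natCast, ← Real.rpow_mul (norm_nonneg z)]
    congr 1; push_cast; ring
  simp only [e, e2] at h1
  refine h1.congr_fderiv ?_
  ext y
  simp
  ring

lemma coord_hasFDeriv (i : Fin 3) (z : E3) :
    HasFDerivAt (fun x : E3 => x i) (EuclideanSpace.proj i : E3 →L[ℝ] ℝ) z :=
  (EuclideanSpace.proj i : E3 →L[ℝ] ℝ).hasFDerivAt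

lemma coord_le (z : E3) (i : Fin 3) : |z i| ≤ ‖z‖ := by
  have := PiLp.norm_apply_le z i
  rwa [Real.norm_eq_abs] at this

lemma second_hasLine (γ : ℝ) (hγ : 0 ≤ γ) (i j : Fin 3) (z : E3) :
    HasLineDerivAt ℝ (fun z : E3 => ‖z‖ ^ γ * (z i * z j))
     (γ * ‖z‖ ^ (γ - 2) * z j * (z i * z j) +
      ‖z‖ ^ γ * ((if i = j then (1 : ℝ) else 0) * z j + z i)) z (EuclideanSpace.single j 1) := by
  by_cases hz : z = 0
  · subst hz
    have : HasFDerivAt (fun z : E3 => ‖z‖ ^ γ * (z i * z j)) (0 : E3 →L[ℝ] ℝ) 0 := by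
      rw [hasFDerivAt_iff_isLittleO_nhds_zero]
      have h2 : (fun h : E3 => ‖h‖ ^ (γ + 2)) =o[nhds 0] fun h => h := by
        have := hasFDerivAt_norm_rpow (0 : E3) (p := γ + 2) (by linarith)
        rw [hasFDerivAt_iff_isLittleO_nhds_zero] at this
        have h0 : (0 : ℝ) ^ (γ + 2) = 0 := Real.zero_rpow (by linarith)
        simpa [h0] using this
      refine Asymptotics.IsBigO.trans_isLittleO ?_ h2
      refine Asymptotics.IsBigO.of_bound 1 (Eventually.of_forall fun h => ?_)
      rw [rpow_add_two' γ hγ]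
      have hi := coord_le h i
      have hj := coord_le h j
      have hn : 0 ≤ ‖h‖ ^ γ := by positivity
      simp only [zero_add, PiLp.zero_apply, mul_zero, sub_zero, _root_.zero_apply, one_mul,
        Real.norm_eq_abs, abs_mul, abs_pow, abs_norm]
      rw [pow_two]
      gcongr
    simpa using this.hasLineDerivAt (EuclideanSpace.single j 1)
  · have := ((hasFDerivAt_norm_rpow_ne γ z hz).mul ((coord_hasFDeriv i z).mul (coord_hasFDeriv j z))).hasLineDerivAt
      (EuclideanSpace.single j 1)
    refine HasDerivAt.congr_deriv this ?_
    simp [EuclideanSpace.inner_single_right]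
    split_ifs <;> ring

lemma afun_hasLine (γ : ℝ) (hγ : 0 ≤ γ) (i j : Fin 3) (z : E3) :
    HasLineDerivAt ℝ (afun γ i j) (adfun γ i j z) z (EuclideanSpace.single j 1) := by
  have h1 := (((hasFDerivAt_norm_rpow z (p := γ + 2) (by linarith)).const_mul
    (if i = j then (1 : ℝ) else 0))).hasLineDerivAt (EuclideanSpace.single j 1)
  have h2 := second_hasLine γ hγ i j z
  have h3 := HasDerivAt.sub h1 h2
  refine HasDerivAt.congr_deriv (f := fun t : ℝ => afun γ i j (z + t • EuclideanSpace.single j 1)) h3 ?_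
  by_cases hij : i = j <;> simp [hij, adfun, EuclideanSpace.inner_single_right]

lemma afun_conv_hasLine (γ : ℝ) (hγ : 0 ≤ γ) (i j : Fin 3) (v w : E3) :
    HasLineDerivAt ℝ (fun w => afun γ i j (v - w)) (-adfun γ i j (v - w)) w
      (EuclideanSpace.single j 1) := by
  have h := afun_hasLine γ hγ i j (v - w)
  unfold HasLineDerivAt at h ⊢
  have h0 : HasDerivAt (fun t : ℝ => -t) (-1) 0 := hasDerivAt_neg 0
  have h' : HasDerivAt (fun t : ℝ => afun γ i j (v - w + t • EuclideanSpace.single j 1))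
    (adfun γ i j (v - w)) (-0) := by simpa using h
  have := HasDerivAt.comp (0 : ℝ) h' h0
  have e : (fun t : ℝ => afun γ i j (v - (w + t • EuclideanSpace.single j 1))) =
      (fun t : ℝ => afun γ i j (v - w + t • EuclideanSpace.single j 1)) ∘ (fun t : ℝ => -t) := by
    funext t
    simp only [Function.comp]
    congr 1
    module
  rw [e]
  exact this.congr_deriv (by ring)

lemma gauss_hasLine (j : Fin 3) (w : E3) :
    HasLineDerivAt ℝ gauss (-(w j * gauss w)) w (EuclideanSpace.single j 1) := by
  have h := ((((hasStrictFDerivAt_norm_sq w).hasFDerivAt.const_mul (-1 / 2 : ℝ)).exp).const_mul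
    ((2 * π) ^ (-(3 : ℝ) / 2))).hasLineDerivAt (EuclideanSpace.single j 1)
  have e : gauss = fun y : E3 => (2 * π) ^ (-(3 : ℝ) / 2) * Real.exp (-1 / 2 * ‖y‖ ^ 2) := by
    ext y; unfold gauss; congr 2; ring
  rw [e]
  refine HasDerivAt.congr_deriv h ?_
  simp [EuclideanSpace.inner_single_right]
  ring

lemma norm_rpow_le_cube (p : ℝ) (h0 : 0 ≤ p) (h3 : p ≤ 3) (z : E3) :
    ‖z‖ ^ p ≤ (1 + ‖z‖) ^ 3 := by
  calc ‖z‖ ^ p ≤ (1 + ‖z‖) ^ p := Real.rpow_le_rpow (norm_nonneg z) (by linarith) h0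
    _ ≤ (1 + ‖z‖) ^ (3 : ℝ) := Real.rpow_le_rpow_of_exponent_le (by linarith [norm_nonneg z]) h3
    _ = _ := by norm_cast

lemma afun_meas (γ : ℝ) (i j : Fin 3) : Measurable (afun γ i j) := by
  unfold afun; fun_prop

lemma adfun_meas (γ : ℝ) (i j : Fin 3) : Measurable (adfun γ i j) := by
  unfold adfun; fun_prop

lemma ite_abs (i j : Fin 3) : |(if i = j then (1 : ℝ) else 0)| ≤ 1 := by
  split_ifs <;> simp

lemma afun_bound (γ : ℝ) (h0 : 0 ≤ γ) (h1 : γ ≤ 1) (i j : Fin 3) (z : E3) :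
    |afun γ i j z| ≤ 2 * (1 + ‖z‖) ^ 3 := by
  have hb := norm_rpow_le_cube (γ + 2) (by linarith) (by linarith) z
  have hi := coord_le z i
  have hj := coord_le z j
  have hd := ite_abs i j
  unfold afun
  have hn : 0 ≤ ‖z‖ ^ γ := by positivity
  have hn2 : 0 ≤ ‖z‖ ^ (γ + 2) := by positivity
  refine (abs_sub _ _).trans ?_
  rw [abs_mul, abs_mul, abs_mul, abs_of_nonneg hn, abs_of_nonneg hn2]
  have e1 : ‖z‖ ^ γ * (|z i| * |z j|) ≤ ‖z‖ ^ γ * (‖z‖ * ‖z‖) := by gcongr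
  have e2 : |(if i = j then (1 : ℝ) else 0)| * ‖z‖ ^ (γ + 2) ≤ 1 * ‖z‖ ^ (γ + 2) := by gcongr
  have e3 := rpow_add_two' γ h0 z
  nlinarith

lemma adfun_bound (γ : ℝ) (h0 : 0 ≤ γ) (h1 : γ ≤ 1) (i j : Fin 3) (z : E3) :
    |adfun γ i j z| ≤ 6 * (1 + ‖z‖) ^ 3 := by
  have hb := norm_rpow_le_cube (γ + 1) (by linarith) (by linarith) z
  have hi := coord_le z i
  have hj := coord_le z j
  have hd := ite_abs i j
  have hn : 0 ≤ ‖z‖ ^ γ := by positivity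
  have hn2 : 0 ≤ ‖z‖ ^ (γ - 2) := by positivity
  have e0 : ‖z‖ ^ (γ + 1) = ‖z‖ ^ γ * ‖z‖ := by
    have := Real.rpow_add_of_nonneg (norm_nonneg z) h0 (show (0 : ℝ) ≤ 1 by norm_num)
    rw [this, Real.rpow_one]
  have e1 : ‖z‖ ^ (γ - 2) * (‖z‖ * (‖z‖ * ‖z‖)) = ‖z‖ ^ (γ + 1) := by
    by_cases hz : z = 0
    · rw [hz, norm_zero, Real.zero_rpow (by linarith : γ + 1 ≠ 0)]; simp
    · have hp : 0 < ‖z‖ := by simpa using hz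
      have : γ + 1 = (γ - 2) + (3 : ℕ) := by push_cast; ring
      rw [this, Real.rpow_add_natCast hp.ne']; ring
  unfold adfun
  set d : ℝ := if i = j then (1 : ℝ) else 0
  have t1 : |d * ((γ + 2) * ‖z‖ ^ γ * z j)| ≤ 3 * ‖z‖ ^ (γ + 1) := by
    rw [abs_mul, abs_mul, abs_mul, abs_of_nonneg hn, abs_of_nonneg (by linarith : 0 ≤ γ + 2)]
    calc |d| * ((γ + 2) * ‖z‖ ^ γ * |z j|) ≤ 1 * ((1 + 2) * ‖z‖ ^ γ * ‖z‖) := by gcongr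
      _ = _ := by rw [e0]; ring
  have t2 : |γ * ‖z‖ ^ (γ - 2) * z j * (z i * z j)| ≤ ‖z‖ ^ (γ + 1) := by
    rw [abs_mul, abs_mul, abs_mul, abs_mul, abs_of_nonneg hn2, abs_of_nonneg h0]
    calc γ * ‖z‖ ^ (γ - 2) * |z j| * (|z i| * |z j|) ≤ 1 * ‖z‖ ^ (γ - 2) * ‖z‖ * (‖z‖ * ‖z‖) := by gcongr
      _ = _ := by rw [← e1]; ring
  have t3 : |‖z‖ ^ γ * (d * z j + z i)| ≤ 2 * ‖z‖ ^ (γ + 1) := by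
    rw [abs_mul, abs_of_nonneg hn]
    have : |d * z j + z i| ≤ 1 * ‖z‖ + ‖z‖ := by
      refine (abs_add_le _ _).trans ?_
      rw [abs_mul]
      gcongr
    calc ‖z‖ ^ γ * |d * z j + z i| ≤ ‖z‖ ^ γ * (1 * ‖z‖ + ‖z‖) := by gcongr
      _ = _ := by rw [e0]; ring
  refine (abs_sub _ _).trans ?_
  have := abs_add_le (γ * ‖z‖ ^ (γ - 2) * z j * (z i * z j)) (‖z‖ ^ γ * (d * z j + z i))
  linarith

lemma parts (γ : ℝ) (h0 : 0 ≤ γ) (h1 : γ ≤ 1) (i j : Fin 3) (v : E3) :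
    ∫ w, afun γ i j (v - w) * (w j * gauss w) = - ∫ w, adfun γ i j (v - w) * gauss w := by
  have ia := integrable_conv _ (afun_meas γ i j) 2 v (afun_bound γ h0 h1 i j)
  have id := integrable_conv _ (adfun_meas γ i j) 6 v (adfun_bound γ h0 h1 i j)
  have := integral_bilinear_hasLineDerivAt_right_eq_neg_left_of_integrable (μ := (volume : Measure E3))
    (f := fun w => afun γ i j (v - w)) (f' := fun w => -adfun γ i j (v - w)) (g := gauss)
    (g' := fun w => -(w j * gauss w)) (v := EuclideanSpace.single j 1)
    (B := ContinuousLinearMap.mul ℝ ℝ)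
    (by simpa using id.1.neg) (by simpa using (ia.2 j).neg) (by simpa using ia.1)
    (fun w _ => afun_conv_hasLine γ h0 i j v w) (fun w _ => gauss_hasLine j w)
  simp only [ContinuousLinearMap.mul_apply', mul_neg, neg_mul, integral_neg] at this
  linarith

lemma norm_sq3 (z : E3) : ‖z‖ ^ 2 = z 0 ^ 2 + z 1 ^ 2 + z 2 ^ 2 := by
  rw [EuclideanSpace.real_norm_sq_eq, Fin.sum_univ_three]

lemma afun_kernel (γ : ℝ) (h0 : 0 ≤ γ) (i : Fin 3) (z : E3) : ∑ j, afun γ i j z * z j = 0 := by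
  simp only [afun, rpow_add_two' γ h0, Fin.sum_univ_three, norm_sq3]
  fin_cases i <;> simp <;> ring

lemma adfun_sum (γ : ℝ) (h0 : 0 ≤ γ) (i : Fin 3) (z : E3) :
    ∑ j, adfun γ i j z = bvec γ z i := by
  have e : ‖z‖ ^ (γ - 2) * (z 0 ^ 2 + z 1 ^ 2 + z 2 ^ 2) * z i = ‖z‖ ^ γ * z i := by
    by_cases hz : z = 0
    · simp [hz]
    · have hp : 0 < ‖z‖ := by simpa using hz
      have : γ = (γ - 2) + (2 : ℕ) := by push_cast; ring
      conv_rhs => rw [this, Real.rpow_add_natCast hp.ne']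
      rw [norm_sq3]
  simp only [adfun, bvec, Fin.sum_univ_three]
  fin_cases i <;> simp [-mul_eq_mul_right_iff] at e ⊢ <;> linear_combination (-γ) * e

lemma part1 (γ : ℝ) (h0 : 0 ≤ γ) (h1 : γ ≤ 1) (v : E3) (i : Fin 3) :
    bbar γ v i = -(∑ j, abar γ v i j * v j) := by
  have ia := fun j => integrable_conv _ (afun_meas γ i j) 2 v (afun_bound γ h0 h1 i j)
  have id := fun j => integrable_conv _ (adfun_meas γ i j) 6 v (adfun_bound γ h0 h1 i j)
  have hb : bbar γ v i = ∑ j, ∫ w, adfun γ i j (v - w) * gauss w := by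
    rw [← integral_finsetSum _ fun j _ => (id j).1]
    unfold bbar
    congr 1; ext w
    rw [← adfun_sum γ h0, Finset.sum_mul]
  have ha : ∑ j, abar γ v i j * v j = ∑ j, ∫ w, afun γ i j (v - w) * (w j * gauss w) := by
    rw [← integral_finsetSum _ fun j _ => (ia j).2 j]
    simp only [abar, amat_eq γ h0, ← integral_mul_const]
    rw [← integral_finsetSum _ fun j _ => (ia j).1.mul_const _]
    congr 1; ext w
    have hk := afun_kernel γ h0 i (v - w)
    simp only [Fin.sum_univ_three, PiLp.sub_apply] at hk ⊢
    linear_combination gauss w * hk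
  rw [hb, ha]
  simp only [parts γ h0 h1]
  simp

lemma bbar_eq (γ : ℝ) (v : E3) (i : Fin 3) : bbar γ v i = ∫ z, bvec γ z i * gauss (v - z) := by
  unfold bbar
  rw [← integral_sub_left_eq_self _ volume v]
  simp

lemma bvec_int (γ : ℝ) (h0 : 0 ≤ γ) (h1 : γ ≤ 1) (v : E3) (i : Fin 3) :
    Integrable fun z => bvec γ z i * gauss (v - z) := by
  have hm : Measurable fun z => bvec γ z i := by unfold bvec; fun_prop
  have := (integrable_conv _ hm 18 v fun z => ?_).1
  · have := this.comp_sub_left v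
    simpa using this
  · simp only [← adfun_sum γ h0]
    refine (Finset.abs_sum_le_sum_abs _ _).trans ?_
    rw [Fin.sum_univ_three]
    have a := adfun_bound γ h0 h1 i 0 z
    have b := adfun_bound γ h0 h1 i 1 z
    have c := adfun_bound γ h0 h1 i 2 z
    linarith

lemma gauss_norm {x y : E3} (h : ‖x‖ = ‖y‖) : gauss x = gauss y := by
  unfold gauss; rw [h]

lemma inner3 (x y : E3) : inner ℝ x y = ∑ i, x i * y i := by
  simp [PiLp.inner_apply, mul_comm]

lemma orth (γ : ℝ) (h0 : 0 ≤ γ) (h1 : γ ≤ 1) (v x : E3) (hx : inner ℝ x v = 0) :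
    ∑ i, x i * bbar γ v i = 0 := by
  have e : ∑ i, x i * bbar γ v i = ∫ z, -2 * ‖z‖ ^ γ * inner ℝ x z * gauss (v - z) := by
    simp only [bbar_eq, ← integral_const_mul]
    rw [← integral_finsetSum _ fun j _ => (bvec_int γ h0 h1 v j).const_mul _]
    congr 1; ext z
    rw [inner3]
    simp only [bvec, Fin.sum_univ_three]; ring
  rw [e]
  set R := (Submodule.span ℝ {x})ᗮ.reflection with hR
  have hv : R v = v := Submodule.reflection_mem_subspace_eq_self
    (Submodule.mem_orthogonal_singleton_iff_inner_right.2 hx)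
  have hxx : R x = -x := Submodule.reflection_orthogonalComplement_singleton_eq_neg x
  have h := R.measurePreserving.integral_comp R.toHomeomorph.measurableEmbedding
    (fun z => -2 * ‖z‖ ^ γ * inner ℝ x z * gauss (v - z))
  have h2 : ∀ z, -2 * ‖R z‖ ^ γ * inner ℝ x (R z) * gauss (v - R z) =
      -(-2 * ‖z‖ ^ γ * inner ℝ x z * gauss (v - z)) := by
    intro z
    have i1 : inner ℝ x (R z) = - inner ℝ x z := by
      have := R.inner_map_map x z
      rw [hxx, inner_neg_left] at this
      linarith
    have i2 : gauss (v - R z) = gauss (v - z) := by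
      apply gauss_norm
      conv_lhs => rw [← hv, ← map_sub, R.norm_map]
    rw [i1, i2, R.norm_map]; ring
  simp only [h2, integral_neg] at h
  linarith

lemma ell1_eq (γ : ℝ) (h0 : 0 ≤ γ) (h1 : γ ≤ 1) (v : E3) (hv : v ≠ 0) :
    ∑ i, v i * bbar γ v i = - ell1 γ v * ‖v‖ ^ 2 := by
  have hp : ‖v‖ ≠ 0 := by simpa using hv
  have ia := fun i j => (integrable_conv _ (afun_meas γ i j) 2 v (afun_bound γ h0 h1 i j)).1
  have ia' : ∀ i j, Integrable fun z => afun γ i j z * gauss (v - z) := fun i j => by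
    simpa using (ia i j).comp_sub_left v
  have e : ∀ i j, abar γ v i j = ∫ z, afun γ i j z * gauss (v - z) := fun i j => by
    unfold abar
    rw [← integral_sub_left_eq_self _ volume v]
    simp [amat_eq γ h0]
  have key : ∑ i, v i * ∑ j, abar γ v i j * v j = ell1 γ v * ‖v‖ ^ 2 := by
    simp only [e, ell1, ← integral_mul_const]
    simp only [← integral_finsetSum _ fun j _ => (ia' _ j).mul_const _, ← integral_const_mul]
    rw [← integral_finsetSum _ fun i _ =>
      (integrable_finsetSum _ fun j _ => (ia' i j).mul_const _).const_mul _]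
    congr 1; ext z
    have e1 : (∑ i, v i / ‖v‖ * (z i / ‖z‖)) = (∑ i, v i * z i) / (‖v‖ * ‖z‖) := by
      rw [Finset.sum_div]
      refine Finset.sum_congr rfl fun i _ => ?_
      rw [div_mul_div_comm]
    have e2 : (1 - (∑ i, v i / ‖v‖ * (z i / ‖z‖)) ^ 2) * ‖z‖ ^ (γ + 2) * ‖v‖ ^ 2
        = ‖z‖ ^ γ * (‖z‖ ^ 2 * ‖v‖ ^ 2 - (∑ i, v i * z i) ^ 2) := by
      rw [e1, rpow_add_two' γ h0]
      by_cases hz : z = 0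
      · simp [hz]
      · have : ‖z‖ ≠ 0 := by simpa using hz
        field_simp
    have e3 : (1 - (∑ i, v i / ‖v‖ * (z i / ‖z‖)) ^ 2) * ‖z‖ ^ (γ + 2) * gauss (v - z) * ‖v‖ ^ 2
        = ‖z‖ ^ γ * (‖z‖ ^ 2 * ‖v‖ ^ 2 - (∑ i, v i * z i) ^ 2) * gauss (v - z) := by
      rw [← e2]; ring
    rw [e3]
    simp only [afun, rpow_add_two' γ h0, norm_sq3, Fin.sum_univ_three]
    simp
    ring
  simp only [part1 γ h0 h1, mul_neg, Finset.sum_neg_distrib, key]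
  ring

lemma part2 (γ : ℝ) (h0 : 0 ≤ γ) (h1 : γ ≤ 1) (v : E3) (hv : v ≠ 0) (i : Fin 3) :
    bbar γ v i = -(ell1 γ v) * v i := by
  let B : E3 := WithLp.toLp 2 fun i => bbar γ v i
  let x : E3 := B + ell1 γ v • v
  have hB : inner ℝ v B = - ell1 γ v * ‖v‖ ^ 2 := by
    rw [inner3]; exact ell1_eq γ h0 h1 v hv
  have hxv : inner ℝ x v = 0 := by
    simp only [x, inner_add_left, inner_smul_left, real_inner_self_eq_norm_sq]
    rw [real_inner_comm, hB]; simp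
  have hxB : inner ℝ x B = 0 := by
    rw [inner3]; exact orth γ h0 h1 v x hxv
  have hxx : inner ℝ x x = 0 := by
    conv_lhs => arg 3; simp only [x]
    rw [inner_add_right, inner_smul_right, hxv, hxB]; simp
  have hx0 : x = 0 := inner_self_eq_zero.1 hxx
  have := congrArg (fun y : E3 => y i) hx0
  simp [x, B] at this
  linarith

/-- `b̄_i(v) = -ā_{ij}(v) v_j`; in particular `b̄(v) = -ℓ₁(v) v` for `v ≠ 0`. -/
theorem stmt9 (γ : ℝ) (hγ0 : 0 ≤ γ) (hγ1 : γ ≤ 1) :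
    (∀ (v : E3) (i : Fin 3), bbar γ v i = -(∑ j, abar γ v i j * v j)) ∧
    (∀ v : E3, v ≠ 0 → ∀ i : Fin 3, bbar γ v i = -(ell1 γ v) * v i) := by
  exact ⟨part1 γ hγ0 hγ1, part2 γ hγ0 hγ1⟩
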